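/- arXiv:1412.0163 — 2 statements merged into one kernel-verified Lean document; each statement's English description precedes it below -/
import Mathlib

section
/- For integer s ≥ 1, lim_{q→1⁻} (1-q)^s · Σ_{n>0} Σ_{d>0} d^{s-1} q^{nd} / (s-1)! = ζ(s) when s ≥ 2; more generally for s_1 ≥ 2 and s_2,…,s_l ≥ 1, lim_{q→1⁻} (1-q)^{s_1+⋯+s_l} [s_1,…,s_l] = ζ(s_1,…,s_l), where [s_1,…,s_l] = (1/∏(s_j-1)!) Σ_{n_1>⋯>n_l>0, d_1,…,d_l>0} ∏ d_j^{s_j-1} q^{Σ n_j d_j} and ζ(s_1,…,s_l) = Σ_{n_1>⋯>n_l>0} ∏ n_j^{-s_j}. -/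
open Filter
open scoped Nat

/-- The mono-bracket `[s₁,…,s_l](q)`. -/
noncomputable def monoBracket (l : ℕ) (s : Fin l → ℕ) (q : ℝ) : ℝ :=
  (∏ j : Fin l, ((s j - 1)! : ℝ))⁻¹ *
    ∑' x : {n : Fin l → ℕ // (∀ i j, i < j → n j < n i) ∧ ∀ i, 0 < n i} × (Fin l → ℕ+),
      (∏ j : Fin l, ((x.2 j : ℕ) : ℝ) ^ (s j - 1)) * q ^ (∑ j : Fin l, x.1.1 j * (x.2 j : ℕ))

/-- The multiple zeta value `ζ(s₁,…,s_l)`. -/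
noncomputable def MZV (l : ℕ) (s : Fin l → ℕ) : ℝ :=
  ∑' n : {n : Fin l → ℕ // (∀ i j, i < j → n j < n i) ∧ ∀ i, 0 < n i},
    ∏ j : Fin l, (1 : ℝ) / ((n.1 j : ℝ) ^ (s j))

/-- The bracket kernel `(1-q)^s/(s-1)! ∑_{d>0} d^{s-1} q^{nd}` attached to one index `n`. -/
noncomputable def bracketFactor (s n : ℕ) (q : ℝ) : ℝ :=
  (1 - q) ^ s * (((s - 1)! : ℝ)⁻¹ * ∑' d : ℕ+, ((d : ℕ) : ℝ) ^ (s - 1) * q ^ (n * (d : ℕ)))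

theorem hasSum_mul_of_nonneg {α β : Type*} {f : α → ℝ} {g : β → ℝ} {a b : ℝ}
    (hf : ∀ x, 0 ≤ f x) (hg : ∀ x, 0 ≤ g x) (h : HasSum f a) (h' : HasSum g b) :
    HasSum (fun x : α × β => f x.1 * g x.2) (a * b) :=
  h.mul h' (h.summable.mul_of_nonneg h'.summable hf hg)

/-- A product of summable nonnegative families is summable over tuples, with sum the product
of the sums. -/
theorem hasSum_fin_prod_of_nonneg {α : Type*} {l : ℕ} {f : Fin l → α → ℝ} {a : Fin l → ℝ}
    (hf : ∀ j x, 0 ≤ f j x) (h : ∀ j, HasSum (f j) (a j)) :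
    HasSum (fun x : Fin l → α => ∏ j, f j (x j)) (∏ j, a j) := by
  induction l with
  | zero => simp
  | succ l ih =>
    have ih' : HasSum (fun x : Fin l → α => ∏ j, f j.succ (x j)) (∏ j : Fin l, a j.succ) :=
      ih (fun j => hf j.succ) (fun j => h j.succ)
    have hnonneg (x : Fin l → α) : 0 ≤ ∏ j, f j.succ (x j) :=
      Finset.prod_nonneg fun j _ => hf j.succ (x j)
    have hmul := hasSum_mul_of_nonneg (hf 0) hnonneg (h 0) ih'
    rw [Fin.prod_univ_succ, ← (Fin.consEquiv fun _ => α).hasSum_iff]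
    refine hmul.congr_fun fun x => ?_
    simp [Fin.consEquiv, Fin.prod_univ_succ]

theorem summable_pnat_pow_mul_geometric (k : ℕ) {x : ℝ} (h0 : 0 ≤ x) (h1 : x < 1) :
    Summable fun d : ℕ+ => ((d : ℕ) : ℝ) ^ k * x ^ (d : ℕ) :=
  (summable_pow_mul_geometric_of_norm_lt_one (R := ℝ) k
    (by rwa [Real.norm_of_nonneg h0])).comp_injective PNat.coe_injective

theorem hasSum_factorial_mul_choose_mul_geometric (k : ℕ) {x : ℝ} (h0 : 0 ≤ x) (h1 : x < 1)
    (c : ℝ) :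
    HasSum (fun m : ℕ => (k ! : ℝ) * ((m + k).choose k : ℝ) * (c * x ^ m))
      (k ! * c / (1 - x) ^ (k + 1)) := by
  have h := (hasSum_choose_mul_geometric_of_norm_lt_one (𝕜 := ℝ) k (r := x)
    (by rwa [Real.norm_of_nonneg h0])).mul_left ((k ! : ℝ) * c)
  rw [mul_one_div] at h
  simpa only [mul_mul_mul_comm, mul_assoc, mul_left_comm, mul_comm] using h

theorem tsum_pnat_pow_mul_geometric_le (k : ℕ) {x : ℝ} (h0 : 0 ≤ x) (h1 : x < 1) :
    ∑' d : ℕ+, ((d : ℕ) : ℝ) ^ k * x ^ (d : ℕ) ≤ k ! * x / (1 - x) ^ (k + 1) := by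
  have hs := summable_pow_mul_geometric_of_norm_lt_one (R := ℝ) k (r := x)
    (by rwa [Real.norm_of_nonneg h0])
  rw [tsum_pnat_eq_tsum_succ (f := fun d : ℕ => (d : ℝ) ^ k * x ^ d)]
  have hu := hasSum_factorial_mul_choose_mul_geometric k h0 h1 x
  rw [← hu.tsum_eq]
  refine ((summable_nat_add_iff 1).2 hs).tsum_le_tsum (fun m => ?_) hu.summable
  rw [pow_succ' x m]
  gcongr
  have h := Nat.pow_succ_le_ascFactorial (m + 1) k
  rw [Nat.ascFactorial_eq_factorial_mul_choose] at h
  exact_mod_cast h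

theorem le_tsum_pnat_pow_mul_geometric (k : ℕ) {x : ℝ} (h0 : 0 ≤ x) (h1 : x < 1) :
    k ! * x ^ (k + 1) / (1 - x) ^ (k + 1) ≤ ∑' d : ℕ+, ((d : ℕ) : ℝ) ^ k * x ^ (d : ℕ) := by
  have hl := hasSum_factorial_mul_choose_mul_geometric k h0 h1 (x ^ (k + 1))
  rw [← hl.tsum_eq]
  refine hl.summable.tsum_le_tsum_of_inj (fun m => (m + k).succPNat) (fun a b hab => ?_)
    (fun d _ => by positivity) (fun m => ?_) (summable_pnat_pow_mul_geometric k h0 h1)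
  · simpa using Nat.succPNat_injective hab
  · have h : k ! * (m + k).choose k ≤ (m + k + 1) ^ k := by
      rw [← Nat.descFactorial_eq_factorial_mul_choose]
      exact (Nat.descFactorial_le_pow _ _).trans (Nat.pow_le_pow_left (Nat.le_succ _) _)
    rw [Nat.succPNat_coe, ← pow_add, show k + 1 + m = (m + k).succ by omega]
    gcongr
    exact_mod_cast h

section BracketFactor

variable {s n : ℕ} {q : ℝ}

theorem geomSum_pos_of_pos (hn : 0 < n) (h0 : 0 < q) : 0 < ∑ i ∈ Finset.range n, q ^ i :=
  Finset.sum_pos (fun i _ => by positivity) (Finset.nonempty_range_iff.2 hn.ne')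

theorem bracketFactor_nonneg (h0 : 0 < q) (h1 : q < 1) : 0 ≤ bracketFactor s n q := by
  have := sub_pos.2 h1
  have := tsum_nonneg (g := fun d : ℕ+ => ((d : ℕ) : ℝ) ^ (s - 1) * q ^ (n * (d : ℕ)))
    (L := .unconditional _) fun d => by positivity
  unfold bracketFactor
  positivity

theorem bracketFactor_le (hs : 1 ≤ s) (hn : 0 < n) (h0 : 0 < q) (h1 : q < 1) :
    bracketFactor s n q ≤ q ^ n / (∑ i ∈ Finset.range n, q ^ i) ^ s := by
  obtain ⟨k, rfl⟩ := Nat.exists_eq_add_of_le' hs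
  have hq := sub_pos.2 h1
  have hG := geomSum_pos_of_pos hn h0
  have h := tsum_pnat_pow_mul_geometric_le k (pow_nonneg h0.le n) (pow_lt_one₀ h0.le h1 hn.ne')
  rw [← mul_neg_geom_sum] at h
  simp only [bracketFactor, pow_mul, Nat.add_sub_cancel]
  calc _ ≤ (1 - q) ^ (k + 1) * ((k ! : ℝ)⁻¹ *
        (k ! * q ^ n / ((1 - q) * ∑ i ∈ Finset.range n, q ^ i) ^ (k + 1))) := by gcongr
    _ = _ := by rw [mul_pow]; field_simp

theorem le_bracketFactor (hs : 1 ≤ s) (hn : 0 < n) (h0 : 0 < q) (h1 : q < 1) :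
    (q ^ n) ^ s / (∑ i ∈ Finset.range n, q ^ i) ^ s ≤ bracketFactor s n q := by
  obtain ⟨k, rfl⟩ := Nat.exists_eq_add_of_le' hs
  have hq := sub_pos.2 h1
  have hG := geomSum_pos_of_pos hn h0
  have h := le_tsum_pnat_pow_mul_geometric k (pow_nonneg h0.le n) (pow_lt_one₀ h0.le h1 hn.ne')
  rw [← mul_neg_geom_sum] at h
  simp only [bracketFactor, pow_mul q n, Nat.add_sub_cancel]
  calc _ = (1 - q) ^ (k + 1) * ((k ! : ℝ)⁻¹ *
        (k ! * (q ^ n) ^ (k + 1) / ((1 - q) * ∑ i ∈ Finset.range n, q ^ i) ^ (k + 1))) := by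
        rw [mul_pow]; field_simp
    _ ≤ _ := by gcongr

theorem eventually_mem_Ioo_zero_one : ∀ᶠ q : ℝ in nhdsWithin 1 (Set.Iio 1), 0 < q ∧ q < 1 :=
  Ioo_mem_nhdsLT zero_lt_one

theorem tendsto_bracketFactor (hs : 1 ≤ s) (hn : 0 < n) :
    Tendsto (bracketFactor s n) (nhdsWithin 1 (Set.Iio 1)) (nhds (1 / (n : ℝ) ^ s)) := by
  have hG : Tendsto (fun q : ℝ => (∑ i ∈ Finset.range n, q ^ i) ^ s) (nhdsWithin 1 (Set.Iio 1))
      (nhds ((n : ℝ) ^ s)) := by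
    have : Continuous fun q : ℝ => (∑ i ∈ Finset.range n, q ^ i) ^ s := by fun_prop
    simpa using (this.tendsto 1).mono_left nhdsWithin_le_nhds
  have hx (e : ℕ) : Tendsto (fun q : ℝ => (q ^ n) ^ e) (nhdsWithin 1 (Set.Iio 1)) (nhds 1) := by
    have : Continuous fun q : ℝ => (q ^ n) ^ e := by fun_prop
    simpa using (this.tendsto 1).mono_left nhdsWithin_le_nhds
  have hn0 : (n : ℝ) ^ s ≠ 0 := by positivity
  refine tendsto_of_tendsto_of_tendsto_of_le_of_le' ((hx s).div hG hn0) ((hx 1).div hG hn0) ?_ ?_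
  · filter_upwards [eventually_mem_Ioo_zero_one] with q hq
    exact le_bracketFactor hs hn hq.1 hq.2
  · filter_upwards [eventually_mem_Ioo_zero_one] with q hq
    simpa using bracketFactor_le hs hn hq.1 hq.2

theorem natCast_mul_pow_le_geomSum_sq (r : ℝ) :
    n * r ^ (n - 1) ≤ ∑ i ∈ Finset.range n, (r ^ 2) ^ i := by
  have h : ∑ i ∈ Finset.range n, 2 * r ^ (n - 1)
      ≤ ∑ i ∈ Finset.range n, ((r ^ 2) ^ i + (r ^ 2) ^ (n - 1 - i)) := by
    refine Finset.sum_le_sum fun i hi => ?_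
    have hi' : n - 1 = i + (n - 1 - i) := by have := Finset.mem_range.1 hi; omega
    have := sq_nonneg (r ^ i - r ^ (n - 1 - i))
    rw [pow_right_comm r 2 i, pow_right_comm r 2 (n - 1 - i)]
    conv_lhs => rw [hi', pow_add]
    linarith
  rw [Finset.sum_add_distrib, Finset.sum_range_reflect (fun i => (r ^ 2) ^ i)] at h
  simp only [Finset.sum_const, Finset.card_range, nsmul_eq_mul] at h
  linarith

theorem bracketFactor_le_one_div (hs : 1 ≤ s) (hn : 0 < n) (h0 : 0 < q) (h1 : q < 1) :
    bracketFactor s n q ≤ 1 / (n : ℝ) ^ min s 2 := by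
  have hG := geomSum_pos_of_pos hn h0
  have hG1 : 1 ≤ ∑ i ∈ Finset.range n, q ^ i := by
    simpa using Finset.single_le_sum (f := fun i => q ^ i) (fun i _ => by positivity)
      (Finset.mem_range.2 hn)
  obtain ⟨r, hr0, rfl⟩ : ∃ r : ℝ, 0 < r ∧ r ^ 2 = q := ⟨√q, by positivity, Real.sq_sqrt h0.le⟩
  have hr1 : r ≤ 1 := by nlinarith
  have hsum := natCast_mul_pow_le_geomSum_sq (n := n) r
  refine (bracketFactor_le hs hn h0 h1).trans ?_
  rw [div_le_div_iff₀ (by positivity) (by positivity), one_mul]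
  calc (r ^ 2) ^ n * (n : ℝ) ^ min s 2
      ≤ (r ^ (n - 1)) ^ min s 2 * (n : ℝ) ^ min s 2 := by
        gcongr
        rw [← pow_mul, ← pow_mul]
        refine pow_le_pow_of_le_one hr0.le hr1 ?_
        calc (n - 1) * min s 2 ≤ n * 2 := Nat.mul_le_mul (Nat.sub_le _ _) (min_le_right _ _)
          _ = 2 * n := mul_comm _ _
    _ = (n * r ^ (n - 1)) ^ min s 2 := by rw [mul_pow, mul_comm]
    _ ≤ (∑ i ∈ Finset.range n, (r ^ 2) ^ i) ^ min s 2 := by gcongr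
    _ ≤ _ := pow_le_pow_right₀ hG1 (min_le_left _ _)

end BracketFactor

theorem tsum_bracket_eq_tsum_prod_bracketFactor {ι : Type*} {l : ℕ} {s : Fin l → ℕ}
    {N : ι → Fin l → ℕ} (hs : ∀ j, 1 ≤ s j) (hN : ∀ i j, 0 < N i j)
    (hsum : Summable fun i => ∏ j, 1 / (N i j : ℝ) ^ min (s j) 2)
    {q : ℝ} (h0 : 0 < q) (h1 : q < 1) :
    (1 - q) ^ (∑ j, s j) * ((∏ j, ((s j - 1)! : ℝ))⁻¹ * ∑' x : ι × (Fin l → ℕ+),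
      (∏ j, ((x.2 j : ℕ) : ℝ) ^ (s j - 1)) * q ^ (∑ j, N x.1 j * (x.2 j : ℕ)))
      = ∑' i, ∏ j, bracketFactor (s j) (N i j) q := by
  have hinner (i : ι) : HasSum (fun d : Fin l → ℕ+ => (1 - q) ^ (∑ j, s j) *
      ((∏ j, ((s j - 1)! : ℝ))⁻¹ * ((∏ j, ((d j : ℕ) : ℝ) ^ (s j - 1)) *
        q ^ (∑ j, N i j * (d j : ℕ))))) (∏ j, bracketFactor (s j) (N i j) q) := by
    have h := hasSum_fin_prod_of_nonneg
      (f := fun j (d : ℕ+) => (1 - q) ^ s j * (((s j - 1)! : ℝ)⁻¹ *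
        (((d : ℕ) : ℝ) ^ (s j - 1) * q ^ (N i j * (d : ℕ)))))
      (a := fun j => bracketFactor (s j) (N i j) q)
      (fun j d => by have := sub_pos.2 h1; positivity)
      (fun j => by
        have := summable_pnat_pow_mul_geometric (s j - 1) (pow_nonneg h0.le (N i j))
          (pow_lt_one₀ h0.le h1 (hN i j).ne')
        simp only [← pow_mul] at this
        exact (this.hasSum.mul_left _).mul_left _)
    convert h using 2 with d
    simp only [Finset.prod_mul_distrib, Finset.prod_pow_eq_pow_sum, Finset.prod_inv_distrib]
  rw [← tsum_mul_left, ← tsum_mul_left, Summable.tsum_prod']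
  · exact tsum_congr fun i => (hinner i).tsum_eq
  · rw [summable_prod_of_nonneg fun x => by have := sub_pos.2 h1; positivity]
    refine ⟨fun i => (hinner i).summable, ?_⟩
    simp only [(hinner _).tsum_eq]
    exact hsum.of_nonneg_of_le
      (fun i => Finset.prod_nonneg fun j _ => bracketFactor_nonneg h0 h1)
      (fun i => Finset.prod_le_prod (fun j _ => bracketFactor_nonneg h0 h1)
        fun j _ => bracketFactor_le_one_div (hs j) (hN i j) h0 h1)
  · exact fun i => (hinner i).summable

/-- Radial limits of bracket-type series over an arbitrary family of index tuples. -/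
theorem tendsto_tsum_bracket {ι : Type*} {l : ℕ} {s : Fin l → ℕ} {N : ι → Fin l → ℕ}
    (hs : ∀ j, 1 ≤ s j) (hN : ∀ i j, 0 < N i j)
    (hsum : Summable fun i => ∏ j, 1 / (N i j : ℝ) ^ min (s j) 2) :
    Tendsto (fun q : ℝ => (1 - q) ^ (∑ j, s j) *
      ((∏ j, ((s j - 1)! : ℝ))⁻¹ * ∑' x : ι × (Fin l → ℕ+),
        (∏ j, ((x.2 j : ℕ) : ℝ) ^ (s j - 1)) * q ^ (∑ j, N x.1 j * (x.2 j : ℕ))))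
      (nhdsWithin 1 (Set.Iio 1)) (nhds (∑' i, ∏ j, 1 / (N i j : ℝ) ^ s j)) := by
  have hlim : Tendsto (fun q : ℝ => ∑' i, ∏ j, bracketFactor (s j) (N i j) q)
      (nhdsWithin 1 (Set.Iio 1)) (nhds (∑' i, ∏ j, 1 / (N i j : ℝ) ^ s j)) := by
    refine tendsto_tsum_of_dominated_convergence hsum
      (fun i => tendsto_finsetProd _ fun j _ => tendsto_bracketFactor (hs j) (hN i j)) ?_
    filter_upwards [eventually_mem_Ioo_zero_one] with q hq i
    rw [Real.norm_of_nonneg (Finset.prod_nonneg fun j _ => bracketFactor_nonneg hq.1 hq.2)]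
    exact Finset.prod_le_prod (fun j _ => bracketFactor_nonneg hq.1 hq.2)
      fun j _ => bracketFactor_le_one_div (hs j) (hN i j) hq.1 hq.2
  refine hlim.congr' ?_
  filter_upwards [eventually_mem_Ioo_zero_one] with q hq
  exact (tsum_bracket_eq_tsum_prod_bracketFactor hs hN hsum hq.1 hq.2).symm

theorem prod_one_div_pow_min_le {m : ℕ} {s n : Fin (m + 1) → ℕ} (h2 : 2 ≤ s 0)
    (hs : ∀ j, 1 ≤ s j) (hn : ∀ i j, i < j → n j < n i) (hpos : ∀ i, 0 < n i) :
    ∏ j, 1 / (n j : ℝ) ^ min (s j) 2 ≤ ∏ j, (n j : ℝ) ^ (-1 - 1 / (m + 1 : ℝ)) := by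
  have hpos' (j) : (0 : ℝ) < n j := by exact_mod_cast hpos j
  have hone (j) : (1 : ℝ) ≤ n j := by exact_mod_cast hpos j
  have hle (j) : (n j : ℝ) ≤ n 0 := by
    rcases eq_or_ne j 0 with rfl | hj
    · exact le_rfl
    · exact_mod_cast (hn 0 j (Fin.pos_of_ne_zero hj)).le
  have hhead : (n 0 : ℝ)⁻¹ ≤ ∏ j, (n j : ℝ) ^ (-(1 / (m + 1 : ℝ))) := by
    calc (n 0 : ℝ)⁻¹ = ∏ _j : Fin (m + 1), (n 0 : ℝ) ^ (-(1 / (m + 1 : ℝ))) := by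
          rw [Finset.prod_const, Finset.card_univ, Fintype.card_fin, ← Real.rpow_natCast,
            ← Real.rpow_mul (hpos' 0).le, ← Real.rpow_neg_one]
          congr 1
          push_cast
          field_simp
      _ ≤ _ := Finset.prod_le_prod (fun j _ => by positivity) fun j _ =>
          Real.rpow_le_rpow_of_nonpos (hpos' j) (hle j) (by rw [neg_nonpos]; positivity)
  calc ∏ j, 1 / (n j : ℝ) ^ min (s j) 2 ≤ (∏ j, (n j : ℝ)⁻¹) * (n 0 : ℝ)⁻¹ := by
        rw [Fin.prod_univ_succ, Fin.prod_univ_succ (fun j => (n j : ℝ)⁻¹), min_eq_right h2,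
          mul_right_comm]
        have h00 : 1 / (n 0 : ℝ) ^ 2 = (n 0 : ℝ)⁻¹ * (n 0 : ℝ)⁻¹ := by ring
        rw [h00]
        gcongr with j
        rw [one_div]
        refine inv_anti₀ (hpos' _) ?_
        exact le_self_pow₀ (hone _) (lt_min (hs j.succ) two_pos).ne'
    _ ≤ (∏ j, (n j : ℝ)⁻¹) * ∏ j, (n j : ℝ) ^ (-(1 / (m + 1 : ℝ))) := by gcongr
    _ = _ := by
        rw [← Finset.prod_mul_distrib]
        refine Finset.prod_congr rfl fun j _ => ?_
        rw [sub_eq_add_neg, Real.rpow_add (hpos' j), Real.rpow_neg_one]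

theorem summable_prod_one_div_pow_min {m : ℕ} {s : Fin (m + 1) → ℕ} (h2 : 2 ≤ s 0)
    (hs : ∀ j, 1 ≤ s j) :
    Summable fun n : {n : Fin (m + 1) → ℕ // (∀ i j, i < j → n j < n i) ∧ ∀ i, 0 < n i} =>
      ∏ j, 1 / (n.1 j : ℝ) ^ min (s j) 2 := by
  have h : Summable fun n : ℕ => (n : ℝ) ^ (-1 - 1 / (m + 1 : ℝ)) :=
    Real.summable_nat_rpow.2 (sub_lt_self _ (by positivity))
  have hprod := (hasSum_fin_prod_of_nonneg (l := m + 1)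
    (f := fun _ (n : ℕ) => (n : ℝ) ^ (-1 - 1 / (m + 1 : ℝ)))
    (fun _ n => by positivity) fun _ => h.hasSum).summable
  exact (hprod.comp_injective Subtype.val_injective).of_nonneg_of_le
    (fun n => by positivity) fun n => prod_one_div_pow_min_le h2 hs n.2.1 n.2.2

/-- `lim_{q→1⁻} (1-q)^s ∑_{n,d>0} d^{s-1} q^{nd}/(s-1)! = ζ(s)` for `s ≥ 2`, and more
generally `lim_{q→1⁻} (1-q)^{s₁+⋯+s_l} [s₁,…,s_l] = ζ(s₁,…,s_l)` for `s₁ ≥ 2`, `s_j ≥ 1`. -/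
theorem bracket_radial_limit :
    (∀ s : ℕ, 2 ≤ s →
      Tendsto
        (fun q : ℝ => (1 - q) ^ s *
          (((s - 1)! : ℝ)⁻¹ *
            ∑' p : ℕ+ × ℕ+, ((p.2 : ℕ) : ℝ) ^ (s - 1) * q ^ ((p.1 : ℕ) * (p.2 : ℕ))))
        (nhdsWithin 1 (Set.Iio 1)) (nhds (∑' n : ℕ+, (1 : ℝ) / ((n : ℕ) : ℝ) ^ s))) ∧
    ∀ (l : ℕ) (s : Fin l → ℕ), 1 ≤ l → (∀ h : 0 < l, 2 ≤ s ⟨0, h⟩) → (∀ j, 1 ≤ s j) →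
      Tendsto (fun q : ℝ => (1 - q) ^ (∑ j, s j) * monoBracket l s q)
        (nhdsWithin 1 (Set.Iio 1)) (nhds (MZV l s)) := by
  constructor
  · intro s hs
    have h := tendsto_tsum_bracket (ι := ℕ+) (l := 1) (s := fun _ => s) (N := fun n _ => n)
      (fun _ => by omega) (fun n _ => n.pos) (by
        simpa [min_eq_right hs, Function.comp_def] using
          (Real.summable_nat_pow_inv.2 one_lt_two).comp_injective PNat.coe_injective)
    simp only [Fin.prod_univ_one, Fin.sum_univ_one] at h
    refine h.congr fun q => ?_
    rw [← ((Equiv.refl ℕ+).prodCongr (Equiv.funUnique (Fin 1) ℕ+)).tsum_eq]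
    rfl
  · intro l s hl h2 hs
    obtain ⟨m, rfl⟩ := Nat.exists_eq_add_of_le' hl
    exact tendsto_tsum_bracket hs (fun n => n.2.2)
      (summable_prod_one_div_pow_min (h2 m.succ_pos) hs)
end

section
/- For weight 3, the multiple q-zeta bracket relation Z(2;2) = (1/2)Z(2;1) + Z(3;1) − Z(2,1;1,1) holds as an identity of q-series on 0 < q < 1, where Z(s_1,…,s_l; r_1,…,r_l) = (1/∏(r_j−1)!(s_j−1)!) Σ_{m_j,d_j>0} ∏ m_j^{r_j−1} d_j^{s_j−1} q^{Σ_i d_i(m_i+⋯+m_l)}. -/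
open scoped Nat

/-- The multiple q-zeta bracket `Z(s₁,…,s_l; r₁,…,r_l)`. -/
noncomputable def qZetaBracket (l : ℕ) (s r : Fin l → ℕ) (q : ℝ) : ℝ :=
  (∏ j : Fin l, (((r j - 1)! : ℝ) * ((s j - 1)! : ℝ)))⁻¹ *
    ∑' md : (Fin l → ℕ+) × (Fin l → ℕ+),
      (∏ j : Fin l, ((md.1 j : ℕ) : ℝ) ^ (r j - 1) * ((md.2 j : ℕ) : ℝ) ^ (s j - 1)) *
        q ^ (∑ i : Fin l, (md.2 i : ℕ) * ∑ j ∈ Finset.Ici i, (md.1 j : ℕ))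

/-- Splitting `ℕ+ × ℕ+` into the parts above, below and on the diagonal. -/
def PNat.addSumEquivProd : (ℕ+ × ℕ+) ⊕ (ℕ+ × ℕ+) ⊕ ℕ+ ≃ ℕ+ × ℕ+ where
  toFun := Sum.elim (fun p ↦ (p.1 + p.2, p.2))
    (Sum.elim (fun p ↦ (p.1, p.1 + p.2)) fun x ↦ (x, x))
  invFun p := if p.2 < p.1 then .inl (p.1 - p.2, p.2) else
    if p.1 < p.2 then .inr (.inl (p.1, p.2 - p.1)) else .inr (.inr p.1)
  left_inv := by
    rintro (⟨a, b⟩ | ⟨a, b⟩ | a)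
    · simp [PNat.lt_add_left]
    · have : ¬ a + b < a := (PNat.lt_add_right a b).asymm
      simp only [Sum.elim_inr, Sum.elim_inl, this, if_false, PNat.lt_add_right, if_true]
      rw [add_comm a b, PNat.add_sub]
    · simp
  right_inv := by
    rintro ⟨a, b⟩
    rcases lt_trichotomy a b with h | rfl | h
    · simp [h, h.asymm, PNat.add_sub_of_lt h]
    · simp
    · simp [h, PNat.sub_add_of_lt h]

theorem tsum_pnat_prod_split {γ : Type*} {f : (ℕ+ × ℕ+) × γ → ℝ} (hf : Summable f) :
    ∑' x, f x = (∑' x : (ℕ+ × ℕ+) × γ, f ((x.1.1 + x.1.2, x.1.2), x.2)) +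
      ((∑' x : (ℕ+ × ℕ+) × γ, f ((x.1.1, x.1.1 + x.1.2), x.2)) +
        ∑' x : ℕ+ × γ, f ((x.1, x.1), x.2)) := by
  let e : ((ℕ+ × ℕ+) × γ) ⊕ ((ℕ+ × ℕ+) × γ) ⊕ (ℕ+ × γ) ≃ (ℕ+ × ℕ+) × γ :=
    ((Equiv.sumCongr (Equiv.refl _) (Equiv.sumProdDistrib (ℕ+ × ℕ+) ℕ+ γ).symm).trans
      (Equiv.sumProdDistrib (ℕ+ × ℕ+) ((ℕ+ × ℕ+) ⊕ ℕ+) γ).symm).trans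
      (PNat.addSumEquivProd.prodCongr (Equiv.refl γ))
  have he : Summable (f ∘ e) := e.summable_iff.2 hf
  have hr := he.comp_injective Sum.inr_injective
  rw [← e.tsum_eq f]
  refine (Summable.tsum_sum (f := f ∘ e) (he.comp_injective Sum.inl_injective) hr).trans ?_
  congr 1
  exact Summable.tsum_sum (f := (f ∘ e) ∘ Sum.inr) (hr.comp_injective Sum.inl_injective)
    (hr.comp_injective Sum.inr_injective)

theorem hasSum_pnat_add {γ : Type*} {h : ℕ+ × γ → ℝ}
    (hh : Summable fun x : (ℕ+ × ℕ+) × γ ↦ h (x.1.1 + x.1.2, x.2)) :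
    HasSum (fun x : ℕ+ × γ ↦ ((x.1 : ℝ) - 1) * h x)
      (∑' x : (ℕ+ × ℕ+) × γ, h (x.1.1 + x.1.2, x.2)) := by
  let g : (ℕ+ × γ) × ℕ+ → ℝ := fun x ↦ if x.2 < x.1.1 then h x.1 else 0
  let i : (ℕ+ × ℕ+) × γ → (ℕ+ × γ) × ℕ+ := fun x ↦ ((x.1.1 + x.1.2, x.2), x.1.1)
  have hi : Function.Injective i := by
    rintro ⟨⟨a, b⟩, c⟩ ⟨⟨a', b'⟩, c'⟩ hx
    simp only [i, Prod.mk.injEq] at hx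
    obtain ⟨⟨hab, rfl⟩, rfl⟩ := hx
    simpa using hab
  have hgi (x) : g (i x) = h (x.1.1 + x.1.2, x.2) := if_pos (PNat.lt_add_right _ _)
  have hg0 (y) (hy : y ∉ Set.range i) : g y = 0 := by
    refine if_neg fun hlt ↦ hy ⟨((y.2, y.1.1 - y.2), y.1.2), ?_⟩
    simp [i, PNat.add_sub_of_lt hlt]
  have hg : Summable g := (hi.summable_iff hg0).1 (by simpa [Function.comp_def, hgi] using hh)
  have hsupp : Function.support g ⊆ Set.range i := fun y hy ↦ by
    by_contra hn
    exact hy (hg0 y hn)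
  have hsum : ∑' x, g x = ∑' x : (ℕ+ × ℕ+) × γ, h (x.1.1 + x.1.2, x.2) := by
    simp only [← hgi, hi.tsum_eq hsupp]
  refine hsum ▸ hg.hasSum.prod_fiberwise fun x ↦ ?_
  have hx := hasSum_sum_of_ne_finset_zero (L := .unconditional ℕ+) (f := fun a ↦ g (x, a))
    (s := Finset.Ico 1 x.1) fun a ha ↦ if_neg fun hlt ↦ ha (Finset.mem_Ico.2 ⟨one_le, hlt⟩)
  rw [Finset.sum_congr rfl fun a ha ↦ if_pos (Finset.mem_Ico.1 ha).2] at hx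
  simpa only [Finset.sum_const, PNat.card_Ico, nsmul_eq_mul, PNat.one_coe,
    Nat.cast_pred x.1.pos] using hx

theorem summable_pnat_quadruple {q : ℝ} (h0 : 0 < q) (h1 : q < 1) :
    Summable fun x : (ℕ+ × ℕ+) × (ℕ+ × ℕ+) ↦
      (x.1.1 : ℝ) * q ^ ((x.1.1 : ℕ) * x.2.1 + x.1.2 * x.2.2) := by
  have hq : ‖q‖ < 1 := by rwa [Real.norm_of_nonneg h0.le]
  have := Summable.mul_of_nonneg (summable_prod_mul_pow 1 hq) (summable_prod_mul_pow 0 hq)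
    (fun _ ↦ by positivity) (fun _ ↦ by positivity)
  refine ((Equiv.prodProdProdComm ℕ+ ℕ+ ℕ+ ℕ+).trans
    ((Equiv.prodComm _ _).prodCongr (Equiv.prodComm _ _))).summable_iff.2 this |>.congr ?_
  rintro ⟨⟨a, b⟩, m, n⟩
  simp only [pow_one, pow_zero, one_mul, Function.comp_apply, pow_add, Equiv.trans_apply,
    Equiv.prodProdProdComm_apply, Equiv.prodCongr_apply, Prod.map, Equiv.prodComm_apply, Prod.swap]
  rw [mul_comm (m : ℕ), mul_comm (n : ℕ), mul_assoc]

theorem tsum_fin_one {f : (Fin 1 → ℕ+) × (Fin 1 → ℕ+) → ℝ} :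
    ∑' x, f x = ∑' x : ℕ+ × ℕ+, f (fun _ ↦ x.2, fun _ ↦ x.1) :=
  (((Equiv.prodComm _ _).trans ((Equiv.funUnique (Fin 1) ℕ+).symm.prodCongr
    (Equiv.funUnique (Fin 1) ℕ+).symm)).tsum_eq f).symm

theorem tsum_fin_two {f : (Fin 2 → ℕ+) × (Fin 2 → ℕ+) → ℝ} :
    ∑' x, f x = ∑' x : (ℕ+ × ℕ+) × (ℕ+ × ℕ+), f (![x.2.1, x.2.2], ![x.1.1, x.1.2]) :=
  (((Equiv.prodComm _ _).trans ((finTwoArrowEquiv ℕ+).symm.prodCongr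
    (finTwoArrowEquiv ℕ+).symm)).tsum_eq f).symm

theorem qZetaBracket_one (s r : ℕ) (q : ℝ) :
    qZetaBracket 1 ![s] ![r] q = (((r - 1)! : ℝ) * ((s - 1)! : ℝ))⁻¹ *
      ∑' x : ℕ+ × ℕ+, (x.2 : ℝ) ^ (r - 1) * (x.1 : ℝ) ^ (s - 1) * q ^ ((x.1 : ℕ) * x.2) := by
  rw [qZetaBracket, tsum_fin_one]
  simp

theorem qZetaBracket_two_one_one_one (q : ℝ) :
    qZetaBracket 2 ![2, 1] ![1, 1] q = ∑' x : (ℕ+ × ℕ+) × (ℕ+ × ℕ+),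
      (x.1.1 : ℝ) * q ^ ((x.1.1 : ℕ) * (x.2.1 + x.2.2) + x.1.2 * x.2.2) := by
  have hI : Finset.Ici (0 : Fin 2) = {0, 1} := rfl
  have hI' : Finset.Ici (1 : Fin 2) = {1} := rfl
  rw [qZetaBracket, tsum_fin_two]
  simp [hI, hI', Fin.sum_univ_two, Fin.prod_univ_two]

theorem summable_qZetaBracket_two_one_one_one {q : ℝ} (h0 : 0 < q) (h1 : q < 1) :
    Summable fun x : (ℕ+ × ℕ+) × (ℕ+ × ℕ+) ↦
      (x.1.1 : ℝ) * q ^ ((x.1.1 : ℕ) * (x.2.1 + x.2.2) + x.1.2 * x.2.2) := by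
  refine ((summable_pnat_quadruple h0 h1).comp_injective
    (i := fun x ↦ (x.1, (x.2.1 + x.2.2, x.2.2))) ?_).congr (by simp)
  rintro ⟨⟨a, b⟩, m, n⟩ ⟨⟨a', b'⟩, m', n'⟩ h
  simp only [Prod.mk.injEq] at h
  obtain ⟨⟨rfl, rfl⟩, h, rfl⟩ := h
  simpa using h

/-- The double shuffle relation obtained from the two expansions of
`∑ a * q ^ (a * m + b * n)`, by comparing `a` with `b` and by comparing `m` with `n`. -/
theorem tsum_shuffle_eq_stuffle {q : ℝ} (h0 : 0 < q) (h1 : q < 1) :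
    ∑' x : (ℕ+ × ℕ+) × ℕ+, (x.1.1 : ℝ) * q ^ (((x.1.1 + x.1.2 : ℕ+) : ℕ) * x.2) =
      (∑' x : (ℕ+ × ℕ+) × (ℕ+ × ℕ+),
        (x.1.1 : ℝ) * q ^ ((x.1.1 : ℕ) * (x.2.1 + x.2.2) + x.1.2 * x.2.2)) +
      ∑' x : (ℕ+ × ℕ+) × ℕ+, (x.2 : ℝ) * q ^ (((x.1.1 + x.1.2 : ℕ+) : ℕ) * x.2) := by
  let f : (ℕ+ × ℕ+) × (ℕ+ × ℕ+) → ℝ := fun x ↦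
    (x.1.1 : ℝ) * q ^ ((x.1.1 : ℕ) * x.2.1 + x.1.2 * x.2.2)
  let fA : (ℕ+ × ℕ+) × (ℕ+ × ℕ+) → ℝ := fun x ↦
    (x.1.1 : ℝ) * q ^ ((x.1.1 : ℕ) * (x.2.1 + x.2.2) + x.1.2 * x.2.2)
  let fS : (ℕ+ × ℕ+) × (ℕ+ × ℕ+) → ℝ := fun x ↦
    (x.1.1 : ℝ) * q ^ ((x.1.1 : ℕ) * x.2.1 + x.1.2 * (x.2.1 + x.2.2))
  let e : (ℕ+ × ℕ+) × (ℕ+ × ℕ+) ≃ (ℕ+ × ℕ+) × (ℕ+ × ℕ+) :=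
    (Equiv.prodComm _ _).prodCongr (Equiv.prodComm _ _)
  have hf : Summable f := summable_pnat_quadruple h0 h1
  have hA : Summable fA := summable_qZetaBracket_two_one_one_one h0 h1
  have hS : Summable fS := by
    refine (hf.comp_injective (i := fun x ↦ (x.1, (x.2.1, x.2.1 + x.2.2))) ?_).congr
      (by simp [f, fS])
    rintro ⟨⟨a, b⟩, m, n⟩ ⟨⟨a', b'⟩, m', n'⟩ h
    simp only [Prod.mk.injEq] at h
    obtain ⟨⟨rfl, rfl⟩, rfl, h⟩ := h
    simpa using h
  have stuffle := tsum_pnat_prod_split hf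
  have shuffle := tsum_pnat_prod_split (f := fun x ↦ f x.swap)
    (((Equiv.prodComm _ _).summable_iff (f := f)).2 hf)
  have h₁ : ∑' x : (ℕ+ × ℕ+) × (ℕ+ × ℕ+), f ((x.1.1 + x.1.2, x.1.2), x.2) =
      ∑' x, fS x + ∑' x, fA x := by
    have hAe : Summable fun x ↦ fA (e x) := (e.summable_iff (f := fA)).2 hA
    rw [← e.tsum_eq fA, ← hS.tsum_add hAe]
    refine tsum_congr fun ⟨⟨a, b⟩, m, n⟩ ↦ ?_
    simp only [f, fS, fA, e, Equiv.prodCongr_apply, Prod.map,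
      Equiv.prodComm_apply, Prod.swap, PNat.add_coe, Nat.cast_add]
    ring
  have h₂ : ∑' x : (ℕ+ × ℕ+) × (ℕ+ × ℕ+), f ((x.1.1, x.1.1 + x.1.2), x.2) = ∑' x, fA x := by
    refine tsum_congr fun ⟨⟨a, b⟩, m, n⟩ ↦ ?_
    simp only [f, fA, PNat.add_coe]
    ring
  have h₃ : ∑' x : ℕ+ × (ℕ+ × ℕ+), f ((x.1, x.1), x.2) =
      ∑' x : (ℕ+ × ℕ+) × ℕ+, (x.2 : ℝ) * q ^ (((x.1.1 + x.1.2 : ℕ+) : ℕ) * x.2) := by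
    rw [← (Equiv.prodComm (ℕ+ × ℕ+) ℕ+).tsum_eq]
    refine tsum_congr fun ⟨⟨a, b⟩, m⟩ ↦ ?_
    simp only [f, PNat.add_coe, Equiv.prodComm_apply, Prod.swap]
    ring
  have h₄ : ∑' x : (ℕ+ × ℕ+) × (ℕ+ × ℕ+), f (x.2, (x.1.1 + x.1.2, x.1.2)) = ∑' x, fA x := by
    rw [← (Equiv.prodComm _ _).tsum_eq fA]
    exact tsum_congr fun _ ↦ by simp [f, fA]
  have h₅ : ∑' x : (ℕ+ × ℕ+) × (ℕ+ × ℕ+), f (x.2, (x.1.1, x.1.1 + x.1.2)) = ∑' x, fS x := by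
    rw [← (Equiv.prodComm _ _).tsum_eq fS]
    exact tsum_congr fun _ ↦ by simp [f, fS]
  have h₆ : ∑' x : ℕ+ × (ℕ+ × ℕ+), f (x.2, (x.1, x.1)) =
      ∑' x : (ℕ+ × ℕ+) × ℕ+, (x.1.1 : ℝ) * q ^ (((x.1.1 + x.1.2 : ℕ+) : ℕ) * x.2) := by
    rw [← (Equiv.prodComm (ℕ+ × ℕ+) ℕ+).tsum_eq]
    refine tsum_congr fun ⟨⟨a, b⟩, m⟩ ↦ ?_
    simp only [f, PNat.add_coe, Equiv.prodComm_apply, Prod.swap]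
    ring
  have hswap : ∑' x : (ℕ+ × ℕ+) × (ℕ+ × ℕ+), f x.swap = ∑' x, f x := (Equiv.prodComm _ _).tsum_eq f
  rw [h₁, h₂, h₃] at stuffle
  simp only [hswap, Prod.swap_prod_mk, h₄, h₅, h₆] at shuffle
  linarith

theorem hasSum_sub_one_mul_mul_pow {q : ℝ} (h0 : 0 < q) (h1 : q < 1) :
    HasSum (fun x : ℕ+ × ℕ+ ↦ ((x.1 : ℝ) - 1) * ((x.2 : ℝ) * q ^ ((x.1 : ℕ) * x.2)))
      (∑' x : (ℕ+ × ℕ+) × ℕ+, (x.2 : ℝ) * q ^ (((x.1.1 + x.1.2 : ℕ+) : ℕ) * x.2)) := by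
  refine hasSum_pnat_add (h := fun x : ℕ+ × ℕ+ ↦ (x.2 : ℝ) * q ^ ((x.1 : ℕ) * x.2)) ?_
  refine ((summable_pnat_quadruple h0 h1).comp_injective
    (i := fun x : (ℕ+ × ℕ+) × ℕ+ ↦ ((x.2, x.2), x.1)) ?_).congr ?_
  · rintro ⟨⟨a, b⟩, m⟩ ⟨⟨a', b'⟩, m'⟩ h
    simp_all
  · rintro ⟨⟨a, b⟩, m⟩
    simp only [Function.comp_apply, PNat.add_coe]
    ring

theorem hasSum_sub_one_mul_self_mul_pow {q : ℝ} (h0 : 0 < q) (h1 : q < 1) :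
    HasSum (fun x : ℕ+ × ℕ+ ↦ ((x.1 : ℝ) - 1) * ((x.1 : ℝ) * q ^ ((x.1 : ℕ) * x.2)))
      (2 * ∑' x : (ℕ+ × ℕ+) × ℕ+,
        (x.1.1 : ℝ) * q ^ (((x.1.1 + x.1.2 : ℕ+) : ℕ) * x.2)) := by
  let f : (ℕ+ × ℕ+) × ℕ+ → ℝ := fun x ↦
    (x.1.1 : ℝ) * q ^ (((x.1.1 + x.1.2 : ℕ+) : ℕ) * x.2)
  let e : (ℕ+ × ℕ+) × ℕ+ ≃ (ℕ+ × ℕ+) × ℕ+ := (Equiv.prodComm _ _).prodCongr (Equiv.refl _)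
  have hf : Summable f := by
    refine ((summable_pnat_quadruple h0 h1).comp_injective
      (i := fun x : (ℕ+ × ℕ+) × ℕ+ ↦ (x.1, (x.2, x.2))) ?_).congr ?_
    · rintro ⟨⟨a, b⟩, m⟩ ⟨⟨a', b'⟩, m'⟩ h
      simp_all
    · simp [f, add_mul]
  have hsymm (x) : f x + (f ∘ e) x =
      ((x.1.1 + x.1.2 : ℕ+) : ℝ) * q ^ (((x.1.1 + x.1.2 : ℕ+) : ℕ) * x.2) := by
    simp only [f, e, Function.comp_apply, Equiv.prodCongr_apply, Prod.map, Equiv.prodComm_apply,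
      Prod.swap, Equiv.refl_apply, PNat.add_coe, Nat.cast_add]
    ring
  have hfe : Summable (f ∘ e) := e.summable_iff.2 hf
  have key := hasSum_pnat_add (h := fun x : ℕ+ × ℕ+ ↦ (x.1 : ℝ) * q ^ ((x.1 : ℕ) * x.2))
    ((hf.add hfe).congr hsymm)
  rw [← tsum_congr hsymm, hf.tsum_add hfe] at key
  rw [two_mul]
  nth_rewrite 2 [← e.tsum_eq]
  exact key

/-- The weight-3 relation `Z(2;2) = (1/2) Z(2;1) + Z(3;1) − Z(2,1;1,1)`. -/
theorem weight_three_relation (q : ℝ) (h0 : 0 < q) (h1 : q < 1) :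
    qZetaBracket 1 ![2] ![2] q =
      (1 / 2) * qZetaBracket 1 ![2] ![1] q + qZetaBracket 1 ![3] ![1] q -
        qZetaBracket 2 ![2, 1] ![1, 1] q := by
  have hq : ‖q‖ < 1 := by rwa [Real.norm_of_nonneg h0.le]
  have hZ₁ : HasSum (fun x : ℕ+ × ℕ+ ↦ (x.1 : ℝ) * q ^ ((x.1 : ℕ) * x.2))
      (qZetaBracket 1 ![2] ![1] q) := by
    have hs : Summable fun x : ℕ+ × ℕ+ ↦ (x.1 : ℝ) * q ^ ((x.1 : ℕ) * x.2) :=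
      (summable_prod_mul_pow 1 hq).prod_symm.congr fun x ↦ by simp [mul_comm (x.1 : ℕ)]
    simpa [qZetaBracket_one] using hs.hasSum
  have hZ₁' : HasSum (fun x : ℕ+ × ℕ+ ↦ (x.2 : ℝ) * q ^ ((x.1 : ℕ) * x.2))
      (qZetaBracket 1 ![2] ![1] q) :=
    ((Equiv.prodComm _ _).hasSum_iff.2 hZ₁).congr_fun fun x ↦ by simp [mul_comm (x.1 : ℕ)]
  have h₂₂ := (hasSum_sub_one_mul_mul_pow h0 h1).add hZ₁'
  have h₃₁ := (hasSum_sub_one_mul_self_mul_pow h0 h1).add hZ₁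
  have e₂₂ : qZetaBracket 1 ![2] ![2] q =
      (∑' x : (ℕ+ × ℕ+) × ℕ+, (x.2 : ℝ) * q ^ (((x.1.1 + x.1.2 : ℕ+) : ℕ) * x.2)) +
        qZetaBracket 1 ![2] ![1] q := by
    rw [qZetaBracket_one, ← h₂₂.tsum_eq]
    simp only [Nat.add_one_sub_one, Nat.factorial_one, Nat.cast_one, mul_one, inv_one, one_mul,
      pow_one]
    exact tsum_congr fun x ↦ by ring
  have e₃₁ : 2 * qZetaBracket 1 ![3] ![1] q =
      2 * (∑' x : (ℕ+ × ℕ+) × ℕ+, (x.1.1 : ℝ) * q ^ (((x.1.1 + x.1.2 : ℕ+) : ℕ) * x.2)) +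
        qZetaBracket 1 ![2] ![1] q := by
    rw [qZetaBracket_one, ← h₃₁.tsum_eq]
    simp only [Nat.sub_self, Nat.factorial_zero, Nat.reduceSub, Nat.factorial_two, Nat.cast_one,
      Nat.cast_ofNat, one_mul, pow_zero, ← mul_assoc]
    rw [mul_inv_cancel₀ two_ne_zero, one_mul]
    exact tsum_congr fun x ↦ by ring
  have key := tsum_shuffle_eq_stuffle h0 h1
  rw [← qZetaBracket_two_one_one_one] at key
  linarith
end
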